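/- Under Assumptions (A1)–(A2) with u ≥ 0, set R₀ = √(2u(0)/m) + √((u(0)+1)d/β) + 1 and E = B̄(0,R₀). Let X and Y be ℝ^d-valued random vectors on a common probability space with E|X − Y|² < ∞ and E|Y|^{l+2} < ∞. Then E[ u( X · 1_E(X) ) ] − E[ u( Y · 1_E(X) ) ] ≤ L (1 + 2R₀)^{l+1} ( E|X − Y|² )^{1/2}, where X · 1_E(X) equals X when |X| ≤ R₀ and 0 otherwise, and Y · 1_E(X) equals Y when |X| ≤ R₀ and 0 otherwise. -/

import Mathlib

open MeasureTheory Real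

local notation "⟪" x ", " y "⟫" => @inner ℝ _ _ x y

/-- The radius `R₀ = √(2u(0)/m) + √((u(0)+1)d/β) + 1`. -/
noncomputable def R0 (d : ℕ) (m β u0 : ℝ) : ℝ :=
  Real.sqrt (2 * u0 / m) + Real.sqrt ((u0 + 1) * d / β) + 1

section StronglyMonotoneGradient

variable {F : Type*} [NormedAddCommGroup F] [InnerProductSpace ℝ F] [CompleteSpace F]

/-- A function whose gradient is strongly monotone lies above its quadratic lower models. -/
lemma quadratic_lower_bound_of_strongly_monotone_gradient {u : F → ℝ} {m : ℝ}
    (hu : Differentiable ℝ u)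
    (hmono : ∀ x y : F, ⟪gradient u x - gradient u y, x - y⟫ ≥ 2 * m * ‖x - y‖ ^ 2) (x y : F) :
    u x + ⟪gradient u x, y - x⟫ + m * ‖y - x‖ ^ 2 ≤ u y := by
  set v := y - x with hv
  have hderiv (t : ℝ) : HasDerivAt (fun t : ℝ => u (x + t • v) - m * ‖v‖ ^ 2 * t ^ 2)
      (⟪gradient u (x + t • v), v⟫ - m * ‖v‖ ^ 2 * (2 * t)) t := by
    have h1 : HasDerivAt (fun t : ℝ => x + t • v) v t := by
      simpa using ((hasDerivAt_id t).smul_const v).const_add x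
    have h2 := (hu (x + t • v)).hasGradientAt.hasFDerivAt.comp_hasDerivAt t h1
    have h3 : HasDerivAt (fun t : ℝ => m * ‖v‖ ^ 2 * t ^ 2) (m * ‖v‖ ^ 2 * (2 * t)) t := by
      simpa using (hasDerivAt_pow 2 t).const_mul (m * ‖v‖ ^ 2)
    simpa only [InnerProductSpace.toDual_apply_apply, Function.comp_apply] using h2.fun_sub h3
  have hlower (t : ℝ) (ht : 0 < t) :
      ⟪gradient u x, v⟫ ≤ ⟪gradient u (x + t • v), v⟫ - m * ‖v‖ ^ 2 * (2 * t) := by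
    have h := hmono (x + t • v) x
    rw [add_sub_cancel_left, inner_smul_right, norm_smul, Real.norm_of_nonneg ht.le,
      inner_sub_left] at h
    have h' : t * (2 * m * t * ‖v‖ ^ 2) ≤
        t * (⟪gradient u (x + t • v), v⟫ - ⟪gradient u x, v⟫) := by
      linarith [h]
    have := le_of_mul_le_mul_left h' ht
    linarith
  have key := (convex_Icc (0 : ℝ) 1).mul_sub_le_image_sub_of_le_deriv
    (f := fun t : ℝ => u (x + t • v) - m * ‖v‖ ^ 2 * t ^ 2)
    (fun t _ => (hderiv t).continuousAt.continuousWithinAt)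
    (fun t _ => (hderiv t).differentiableAt.differentiableWithinAt)
    (C := ⟪gradient u x, v⟫)
    (fun t ht => by
      rw [interior_Icc] at ht
      rw [(hderiv t).deriv]
      exact hlower t ht.1)
    0 (by simp) 1 (by simp) zero_le_one
  have hy : x + v = y := by simp [hv]
  simp [hy, -inner_gradient_left] at key
  linarith

lemma sub_le_norm_gradient_mul_of_strongly_monotone_gradient {u : F → ℝ} {m : ℝ} (hm : 0 ≤ m)
    (hu : Differentiable ℝ u)
    (hmono : ∀ x y : F, ⟪gradient u x - gradient u y, x - y⟫ ≥ 2 * m * ‖x - y‖ ^ 2) (x y : F) :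
    u x - u y ≤ ‖gradient u x‖ * ‖x - y‖ := by
  have h1 := quadratic_lower_bound_of_strongly_monotone_gradient hu hmono x y
  have h2 := neg_le_of_abs_le (abs_real_inner_le_norm (gradient u x) (y - x))
  have h3 : 0 ≤ m * ‖y - x‖ ^ 2 := by positivity
  rw [norm_sub_rev x y]
  linarith

/-- A nonnegative function with strongly monotone gradient has a critical point, whose distance
to the origin is controlled by the value at the origin. -/
lemma exists_gradient_eq_zero_of_strongly_monotone_gradient [ProperSpace F] {u : F → ℝ} {m : ℝ}
    (hm : 0 < m) (hu : Differentiable ℝ u) (hnonneg : ∀ x, 0 ≤ u x)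
    (hmono : ∀ x y : F, ⟪gradient u x - gradient u y, x - y⟫ ≥ 2 * m * ‖x - y‖ ^ 2) :
    ∃ x, gradient u x = 0 ∧ ‖x‖ ≤ √(u 0 / m) := by
  set r := ‖gradient u 0‖ / m with hr
  have hr0 : 0 ≤ r := by positivity
  obtain ⟨x, -, hxmin⟩ := (isCompact_closedBall (0 : F) r).exists_isMinOn
    ⟨0, by simpa using hr0⟩ hu.continuous.continuousOn
  have hx0 : u x ≤ u 0 := hxmin (by simpa using hr0)
  have hglobal (y : F) : u x ≤ u y := by
    by_cases hy : ‖y‖ ≤ r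
    · exact hxmin (by simpa using hy)
    · push Not at hy
      refine hx0.trans ?_
      have h1 := quadratic_lower_bound_of_strongly_monotone_gradient hu hmono 0 y
      have h2 := neg_le_of_abs_le (abs_real_inner_le_norm (gradient u 0) (y - 0))
      rw [sub_zero] at h1 h2
      have h3 : ‖gradient u 0‖ ≤ ‖y‖ * m := by
        rw [hr, div_lt_iff₀ hm] at hy
        exact hy.le
      nlinarith [mul_le_mul_of_nonneg_right h3 (norm_nonneg y)]
  have hgrad : gradient u x = 0 := by
    have : fderiv ℝ u x = 0 :=
      IsLocalMin.fderiv_eq_zero (Filter.Eventually.of_forall hglobal)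
    simp [gradient, this]
  refine ⟨x, hgrad, Real.le_sqrt_of_sq_le ?_⟩
  have h := quadratic_lower_bound_of_strongly_monotone_gradient hu hmono x 0
  rw [hgrad, inner_zero_left, zero_sub, norm_neg] at h
  rw [le_div_iff₀ hm]
  linarith [hnonneg x]

lemma exists_le_const_mul_one_add_norm_rpow {u : F → ℝ} {m L l : ℝ} (hm : 0 ≤ m) (hL : 0 ≤ L)
    (hl : 0 ≤ l) (hu : Differentiable ℝ u) (hnonneg : ∀ x, 0 ≤ u x)
    (hmono : ∀ x y : F, ⟪gradient u x - gradient u y, x - y⟫ ≥ 2 * m * ‖x - y‖ ^ 2)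
    (hlip : ∀ x y : F,
      ‖gradient u x - gradient u y‖ ≤ L * (1 + ‖x‖ + ‖y‖) ^ l * ‖x - y‖) :
    ∃ C, 0 ≤ C ∧ ∀ y, u y ≤ C * (1 + ‖y‖ ^ (l + 2)) := by
  have hu0 := hnonneg 0
  refine ⟨u 0 + ‖gradient u 0‖ + L * 2 ^ l, by positivity, fun y => ?_⟩
  set C := u 0 + ‖gradient u 0‖ + L * 2 ^ l with hC
  have hC0 : 0 ≤ C := by positivity
  have h1 := sub_le_norm_gradient_mul_of_strongly_monotone_gradient hm hu hmono y 0
  have h2 := hlip y 0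
  have h3 := norm_le_norm_add_norm_sub' (gradient u y) (gradient u 0)
  simp only [norm_zero, add_zero, sub_zero] at h1 h2
  have h4 : u y ≤ u 0 + (‖gradient u 0‖ + L * (1 + ‖y‖) ^ l * ‖y‖) * ‖y‖ := by
    have : ‖gradient u y‖ * ‖y‖ ≤ (‖gradient u 0‖ + L * (1 + ‖y‖) ^ l * ‖y‖) * ‖y‖ :=
      mul_le_mul_of_nonneg_right (by linarith) (norm_nonneg y)
    linarith
  refine h4.trans ?_
  have hp : 0 ≤ ‖y‖ ^ (l + 2) := by positivity
  rcases le_total ‖y‖ 1 with hy | hy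
  · calc
      _ ≤ u 0 + (‖gradient u 0‖ + L * (1 + 1) ^ l * 1) * 1 := by gcongr
      _ = C := by rw [hC]; norm_num; ring
      _ ≤ _ := le_mul_of_one_le_right hC0 (by linarith)
  · have hpos : 0 < ‖y‖ := by linarith
    have e1 : (1 + ‖y‖) ^ l ≤ 2 ^ l * ‖y‖ ^ l := by
      rw [← Real.mul_rpow (by norm_num) hpos.le]
      exact Real.rpow_le_rpow (by positivity) (by linarith) hl
    have e2 : ‖y‖ ^ (l + 2) = ‖y‖ ^ l * ‖y‖ ^ 2 := by
      rw [Real.rpow_add hpos, Real.rpow_two]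
    have e3 : 1 ≤ ‖y‖ ^ (l + 2) := Real.one_le_rpow hy (by linarith)
    have e4 : ‖y‖ ≤ ‖y‖ ^ (l + 2) := by
      simpa using Real.rpow_le_rpow_of_exponent_le hy (by linarith : (1 : ℝ) ≤ l + 2)
    have e5 : L * (1 + ‖y‖) ^ l * ‖y‖ ^ 2 ≤ L * 2 ^ l * ‖y‖ ^ (l + 2) := by
      rw [e2]
      calc _ ≤ L * (2 ^ l * ‖y‖ ^ l) * ‖y‖ ^ 2 := by gcongr
        _ = _ := by ring
    calc
      _ = u 0 * 1 + ‖gradient u 0‖ * ‖y‖ + L * (1 + ‖y‖) ^ l * ‖y‖ ^ 2 := by ring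
      _ ≤ u 0 * ‖y‖ ^ (l + 2) + ‖gradient u 0‖ * ‖y‖ ^ (l + 2)
          + L * 2 ^ l * ‖y‖ ^ (l + 2) := by gcongr
      _ = C * ‖y‖ ^ (l + 2) := by rw [hC]; ring
      _ ≤ _ := by gcongr; linarith

end StronglyMonotoneGradient

lemma integral_le_sqrt_integral_sq {Ω : Type*} [MeasurableSpace Ω] {P : Measure Ω}
    [IsProbabilityMeasure P] {f : Ω → ℝ} (hf : Integrable f P)
    (hf2 : Integrable (fun ω => f ω ^ 2) P) :
    ∫ ω, f ω ∂P ≤ √(∫ ω, f ω ^ 2 ∂P) := by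
  refine Real.le_sqrt_of_sq_le ?_
  have h : 0 ≤ ∫ ω, (f ω - ∫ ω', f ω' ∂P) ^ 2 ∂P := integral_nonneg fun ω => sq_nonneg _
  set a := ∫ ω', f ω' ∂P with ha
  have e : (fun ω => (f ω - a) ^ 2) = fun ω => f ω ^ 2 - 2 * a * f ω + a ^ 2 := by
    ext ω; ring
  rw [e, integral_add (f := fun ω => f ω ^ 2 - 2 * a * f ω) (hf2.sub (hf.const_mul _))
    (integrable_const _),
    integral_sub hf2 (hf.const_mul _), integral_const_mul, ← ha] at h
  simp at h
  nlinarith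

theorem stmt_16 (d : ℕ) (hd : 1 ≤ d) (m L l β : ℝ)
    (hm : 0 < m) (hL : 0 < L) (hl : 0 < l) (hβ : 0 < β)
    (u : EuclideanSpace ℝ (Fin d) → ℝ) (hu : ContDiff ℝ 2 u)
    (hnonneg : ∀ x, 0 ≤ u x)
    (hA1 : ∀ x y : EuclideanSpace ℝ (Fin d),
      ⟪gradient u x - gradient u y, x - y⟫ ≥ 2 * m * ‖x - y‖ ^ 2)
    (hA2 : ∀ x y : EuclideanSpace ℝ (Fin d),
      ‖gradient u x - gradient u y‖ ≤ L * (1 + ‖x‖ + ‖y‖) ^ l * ‖x - y‖)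
    {Ω : Type*} [MeasurableSpace Ω] (P : Measure Ω) [IsProbabilityMeasure P]
    (X Y : Ω → EuclideanSpace ℝ (Fin d)) (hX : Measurable X) (hY : Measurable Y)
    (hXY : Integrable (fun ω => ‖X ω - Y ω‖ ^ 2) P)
    (hYmom : Integrable (fun ω => ‖Y ω‖ ^ (l + 2)) P) :
    (∫ ω, u (if ‖X ω‖ ≤ R0 d m β (u 0) then X ω else 0) ∂P)
      - (∫ ω, u (if ‖X ω‖ ≤ R0 d m β (u 0) then Y ω else 0) ∂P) ≤
    L * (1 + 2 * R0 d m β (u 0)) ^ (l + 1) * Real.sqrt (∫ ω, ‖X ω - Y ω‖ ^ 2 ∂P) := by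
  have hdiff : Differentiable ℝ u := hu.differentiable (by norm_num)
  have hmeas : Measurable u := hu.continuous.measurable
  set R := R0 d m β (u 0) with hR
  have hu0 := hnonneg 0
  have hmin : √(u 0 / m) ≤ R := by
    have h1 : √(u 0 / m) ≤ √(2 * u 0 / m) := by
      apply Real.sqrt_le_sqrt
      gcongr
      linarith
    have h2 := Real.sqrt_nonneg ((u 0 + 1) * d / β)
    rw [hR, R0]
    linarith
  have hR0 : 0 ≤ R := (Real.sqrt_nonneg _).trans hmin
  obtain ⟨z, hz, hzR⟩ :=
    exists_gradient_eq_zero_of_strongly_monotone_gradient hm hdiff hnonneg hA1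
  replace hzR := hzR.trans hmin
  set K := L * (1 + 2 * R) ^ (l + 1) with hK
  have hK0 : 0 ≤ K := by positivity
  have hgrad (x : EuclideanSpace ℝ (Fin d)) (hx : ‖x‖ ≤ R) : ‖gradient u x‖ ≤ K := by
    have h := hA2 x z
    rw [hz, sub_zero] at h
    calc
      _ ≤ L * (1 + ‖x‖ + ‖z‖) ^ l * ‖x - z‖ := h
      _ ≤ L * (1 + 2 * R) ^ l * (1 + 2 * R) := by
        have h1 : 1 + ‖x‖ + ‖z‖ ≤ 1 + 2 * R := by linarith
        have h2 : ‖x - z‖ ≤ 1 + 2 * R := by linarith [norm_sub_le x z]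
        gcongr
      _ = K := by rw [hK, Real.rpow_add (by positivity), Real.rpow_one]; ring
  obtain ⟨C, hC, hgrowth⟩ :=
    exists_le_const_mul_one_add_norm_rpow hm.le hL.le hl.le hdiff hnonneg hA1 hA2
  have hset : MeasurableSet {ω | ‖X ω‖ ≤ R} := measurableSet_le hX.norm measurable_const
  have hXint : Integrable (fun ω => u (if ‖X ω‖ ≤ R then X ω else 0)) P := by
    refine Integrable.of_bound
      (hmeas.comp (Measurable.ite hset hX measurable_const)).aestronglyMeasurable
      (C * (1 + R ^ (l + 2))) (Filter.Eventually.of_forall fun ω => ?_)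
    rw [Real.norm_of_nonneg (hnonneg _)]
    refine (hgrowth _).trans ?_
    gcongr
    split_ifs with h
    · exact h
    · simpa using hR0
  have hYint : Integrable (fun ω => u (if ‖X ω‖ ≤ R then Y ω else 0)) P := by
    refine Integrable.mono' (((integrable_const 1).add hYmom).const_mul C)
      (hmeas.comp (Measurable.ite hset hY measurable_const)).aestronglyMeasurable
      (Filter.Eventually.of_forall fun ω => ?_)
    rw [Real.norm_of_nonneg (hnonneg _)]
    refine (hgrowth _).trans ?_
    simp only [Pi.add_apply]
    gcongr
    split_ifs with h
    · exact le_rfl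
    · simp
  have hXY1 : Integrable (fun ω => ‖X ω - Y ω‖) P := by
    have h := (memLp_two_iff_integrable_sq (hX.sub hY).norm.aestronglyMeasurable).2 hXY
    exact h.integrable (by norm_num)
  rw [← integral_sub hXint hYint]
  calc
    _ ≤ ∫ ω, K * ‖X ω - Y ω‖ ∂P := by
      refine integral_mono (hXint.sub hYint) (hXY1.const_mul K) fun ω => ?_
      simp only
      split_ifs with h
      · exact (sub_le_norm_gradient_mul_of_strongly_monotone_gradient hm.le hdiff hA1 _ _).trans
          (mul_le_mul_of_nonneg_right (hgrad _ h) (norm_nonneg _))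
      · rw [sub_self]
        positivity
    _ = K * ∫ ω, ‖X ω - Y ω‖ ∂P := integral_const_mul _ _
    _ ≤ _ := mul_le_mul_of_nonneg_left (integral_le_sqrt_integral_sq hXY1 hXY) hK0
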